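/- Let D ≥ 3 and let G be a D-regular graph whose adjacency matrix has second-largest eigenvalue λ₂. Then the Cheeger constant h of G satisfies (D - λ₂)/2 ≤ h ≤ √(2D(D - λ₂)). -/

import Mathlib

open Finset

namespace CheegerAux

variable {V : Type*} [Fintype V] [DecidableEq V]

/-- indicator -/
noncomputable def ind (S : Finset V) (x : V) : ℝ := if x ∈ S then 1 else 0

noncomputable def bd (A : V → V → ℝ) (S : Finset V) : ℝ :=
  ∑ x, ∑ y, A x y * (ind S x * (1 - ind S y))

lemma bd_two (A : V → V → ℝ) (hs : ∀ x y, A x y = A y x) (S : Finset V) :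
    ∑ x, ∑ y, A x y * (ind S x * (1 - ind S y) + ind S y * (1 - ind S x)) = 2 * bd A S := by
  have h1 : ∑ x, ∑ y, A x y * (ind S y * (1 - ind S x)) = bd A S := by
    rw [Finset.sum_comm]
    unfold bd
    refine Finset.sum_congr rfl fun x _ => Finset.sum_congr rfl fun y _ => ?_
    rw [hs]
  simp only [mul_add, Finset.sum_add_distrib]
  rw [h1]
  unfold bd
  ring

lemma coarea (A : V → V → ℝ) (hs : ∀ x y, A x y = A y x) (hc : ℝ) (N : ℕ)
    (hS : ∀ S : Finset V, S.Nonempty → 2 * S.card ≤ N → hc * S.card ≤ bd A S) :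
    ∀ (k : ℕ) (F : V → ℝ), (∀ x, 0 ≤ F x) → (univ.filter fun x => 0 < F x).card = k →
      2 * k ≤ N → 2 * hc * ∑ x, F x ≤ ∑ x, ∑ y, A x y * |F x - F y| := by
  intro k
  induction k using Nat.strong_induction_on with
  | _ k ih =>
  intro F hF hk hkN
  set S := univ.filter fun x => 0 < F x with hSdef
  by_cases hne : S.Nonempty
  · obtain ⟨z, hz, hmin⟩ := Finset.exists_min_image S F hne
    have hz0 : 0 < F z := (Finset.mem_filter.1 hz).2
    have hmem : ∀ x, x ∈ S ↔ 0 < F x := fun x => by simp [hSdef]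
    have hnot : ∀ x, x ∉ S → F x = 0 := fun x hx =>
      le_antisymm (not_lt.1 (fun h => hx ((hmem x).2 h))) (hF x)
    set F' : V → ℝ := fun x => F x - F z * ind S x with hF'
    have hF'0 : ∀ x, 0 ≤ F' x := by
      intro x
      by_cases hx : x ∈ S
      · have := hmin x hx
        simp [hF', ind, hx, this]
      · simp [hF', ind, hx, hnot x hx]
    have hlt : (univ.filter fun x => 0 < F' x).card < k := by
      rw [← hk]
      apply Finset.card_lt_card
      refine ⟨?_, ?_⟩
      · intro x hx
        by_contra hxS
        have := (Finset.mem_filter.1 hx).2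
        simp [hF', ind, hxS, hnot x hxS] at this
      · intro hsub
        have := (Finset.mem_filter.1 (hsub hz)).2
        simp [hF', ind, hz] at this
    have key := ih _ hlt F' hF'0 rfl (by omega)
    have hdec : ∀ x y, |F x - F y| = |F' x - F' y| +
        F z * (ind S x * (1 - ind S y) + ind S y * (1 - ind S x)) := by
      intro x y
      by_cases hx : x ∈ S <;> by_cases hy : y ∈ S
      · simp [hF', ind, hx, hy]
      · have h1 := hmin x hx
        simp only [hF', ind, hx, hy, hnot y hy, if_true, if_false]
        rw [abs_of_nonneg (by linarith), abs_of_nonneg (by linarith)]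
        ring
      · have h1 := hmin y hy
        simp only [hF', ind, hx, hy, hnot x hx, if_true, if_false]
        rw [abs_of_nonpos (by linarith), abs_of_nonpos (by linarith)]
        ring
      · simp [hF', ind, hx, hy, hnot x hx, hnot y hy]
    have hsum : ∑ x, F x = ∑ x, F' x + F z * S.card := by
      have : ∑ x, ind S x = (S.card : ℝ) := by simp [ind]
      rw [← this, Finset.mul_sum, ← Finset.sum_add_distrib]
      exact Finset.sum_congr rfl fun x _ => by simp [hF']
    have hE : ∑ x, ∑ y, A x y * |F x - F y| =
        ∑ x, ∑ y, A x y * |F' x - F' y| + F z * (2 * bd A S) := by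
      rw [← bd_two A hs S, Finset.mul_sum, ← Finset.sum_add_distrib]
      refine Finset.sum_congr rfl fun x _ => ?_
      rw [Finset.mul_sum, ← Finset.sum_add_distrib]
      refine Finset.sum_congr rfl fun y _ => ?_
      rw [hdec]; ring
    have hb := hS S hne (by omega)
    have := mul_le_mul_of_nonneg_left hb hz0.le
    rw [hsum, hE]
    linarith
  · have h0 : ∀ x, F x = 0 := fun x =>
      le_antisymm (not_lt.1 (fun h => hne ⟨x, by simp [hSdef, h]⟩)) (hF x)
    simp [h0]

lemma energy (A : V → V → ℝ) (hs : ∀ x y, A x y = A y x) (D : ℝ)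
    (hD : ∀ x, ∑ y, A x y = D) (c : ℝ) (f : V → ℝ) :
    ∑ x, ∑ y, A x y * (f x + c * f y) ^ 2 =
      (1 + c ^ 2) * D * ∑ x, f x ^ 2 + 2 * c * ∑ x, f x * ∑ y, A x y * f y := by
  have h1 : ∑ x, ∑ y, A x y * f x ^ 2 = D * ∑ x, f x ^ 2 := by
    simp only [← Finset.sum_mul, hD, ← Finset.mul_sum]
  have h2 : ∑ x, ∑ y, A x y * f y ^ 2 = D * ∑ x, f x ^ 2 := by
    rw [Finset.sum_comm, ← h1]
    refine Finset.sum_congr rfl fun x _ => Finset.sum_congr rfl fun y _ => ?_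
    rw [hs]
  have : ∀ x y, A x y * (f x + c * f y) ^ 2 =
      A x y * f x ^ 2 + c ^ 2 * (A x y * f y ^ 2) + 2 * c * (f x * (A x y * f y)) := by
    intro x y; ring
  simp only [this, Finset.sum_add_distrib, ← Finset.mul_sum, h1, h2]
  ring

/-- The hard direction, for a function with small positive support. -/
lemma hard (A : V → V → ℝ) (hs : ∀ x y, A x y = A y x) (hA : ∀ x y, 0 ≤ A x y) (D : ℝ)
    (hD : ∀ x, ∑ y, A x y = D) (hc : ℝ) (N : ℕ) (h0 : 0 ≤ hc)
    (hS : ∀ S : Finset V, S.Nonempty → 2 * S.card ≤ N → hc * S.card ≤ bd A S)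
    (g : V → ℝ) (l : ℝ) (hg : ∀ x, ∑ y, A x y * g y = l * g x)
    (hpos : ∃ x, 0 < g x) (hN : 2 * (univ.filter fun x => 0 < g x).card ≤ N) :
    hc ^ 2 ≤ 2 * D * (D - l) := by
  set f : V → ℝ := fun x => max (g x) 0 with hf
  have hf0 : ∀ x, 0 ≤ f x := fun x => le_max_right _ _
  have hD0 : 0 ≤ D := by
    obtain ⟨x, _⟩ := hpos
    rw [← hD x]; exact Finset.sum_nonneg fun y _ => hA x y
  set Q := ∑ x, f x ^ 2 with hQ
  have hQpos : 0 < Q := by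
    obtain ⟨x, hx⟩ := hpos
    refine Finset.sum_pos' (fun x _ => sq_nonneg _) ⟨x, mem_univ _, ?_⟩
    have : 0 < f x := lt_max_of_lt_left hx
    positivity
  have hray : l * Q ≤ ∑ x, f x * ∑ y, A x y * f y := by
    rw [hQ, Finset.mul_sum]
    refine Finset.sum_le_sum fun x _ => ?_
    by_cases hx : 0 < g x
    · have e : f x = g x := max_eq_left hx.le
      have : l * f x ≤ ∑ y, A x y * f y := by
        rw [e, ← hg]
        exact Finset.sum_le_sum fun y _ => mul_le_mul_of_nonneg_left (le_max_left _ _) (hA x y)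
      have := mul_le_mul_of_nonneg_left this (hf0 x)
      linarith
    · have e : f x = 0 := max_eq_right (not_lt.1 hx)
      simp [e]
  have hco := coarea A hs hc N hS _ (fun x => f x ^ 2) (fun x => sq_nonneg _) rfl (by
    refine le_trans (Nat.mul_le_mul_left 2 (Finset.card_le_card ?_)) hN
    intro x hx
    simp only [Finset.mem_filter, mem_univ, true_and] at hx ⊢
    by_contra hx'
    have e : f x = 0 := max_eq_right (not_lt.1 hx')
    simp [e] at hx)
  have e1 := energy A hs D hD (-1) f
  have e2 := energy A hs D hD 1 f
  set P := ∑ x, f x * ∑ y, A x y * f y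
  have hCS : (∑ x, ∑ y, A x y * |f x ^ 2 - f y ^ 2|) ^ 2 ≤
      (∑ x, ∑ y, A x y * (f x + (-1) * f y) ^ 2) * (∑ x, ∑ y, A x y * (f x + 1 * f y) ^ 2) := by
    simp only [← Fintype.sum_prod_type' (f := fun x y => A x y * |f x ^ 2 - f y ^ 2|),
      ← Fintype.sum_prod_type' (f := fun x y => A x y * (f x + (-1) * f y) ^ 2),
      ← Fintype.sum_prod_type' (f := fun x y => A x y * (f x + 1 * f y) ^ 2)]
    refine Finset.sum_sq_le_sum_mul_sum_of_sq_le_mul _ ?_ ?_ ?_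
    · intro p _; exact mul_nonneg (hA _ _) (sq_nonneg _)
    · intro p _; exact mul_nonneg (hA _ _) (sq_nonneg _)
    · intro p _; apply le_of_eq; rw [mul_pow, sq_abs]; ring
  have hE1 : 0 ≤ ∑ x, ∑ y, A x y * (f x + (-1) * f y) ^ 2 :=
    Finset.sum_nonneg fun x _ => Finset.sum_nonneg fun y _ => mul_nonneg (hA _ _) (sq_nonneg _)
  rw [e1, e2] at hCS
  rw [e1] at hE1
  have hsq : (2 * hc * Q) ^ 2 ≤ (∑ x, ∑ y, A x y * |f x ^ 2 - f y ^ 2|) ^ 2 :=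
    pow_le_pow_left₀ (by positivity) hco 2
  have hfin : (2 * hc * Q) ^ 2 ≤ (2 * (D - l) * Q) * (4 * D * Q) := by
    refine hsq.trans (hCS.trans ?_)
    apply mul_le_mul
    · linarith
    · linarith
    · have := Finset.sum_nonneg fun x (_ : x ∈ univ) => Finset.sum_nonneg fun y (_ : y ∈ univ) =>
        mul_nonneg (hA x y) (sq_nonneg (f x + 1 * f y))
      rw [e2] at this
      exact this
    · linarith
  have hQ2 : 0 < 4 * Q ^ 2 := by positivity
  refine le_of_mul_le_mul_left ?_ hQ2
  linarith

lemma const_of_energy (G : SimpleGraph V) [DecidableRel G.Adj] (hconn : G.Connected)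
    (f : V → ℝ) (h : ∑ x, ∑ y, G.adjMatrix ℝ x y * (f x + (-1) * f y) ^ 2 = 0) :
    ∀ x y, f x = f y := by
  have hA : ∀ x y, 0 ≤ G.adjMatrix ℝ x y * (f x + (-1) * f y) ^ 2 := by
    intro x y
    refine mul_nonneg ?_ (sq_nonneg _)
    rw [SimpleGraph.adjMatrix_apply]; split_ifs <;> norm_num
  have hadj : ∀ x y, G.Adj x y → f x = f y := by
    intro x y hxy
    have h1 := (Finset.sum_eq_zero_iff_of_nonneg
      (fun x _ => Finset.sum_nonneg fun y _ => hA x y)).1 h x (mem_univ _)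
    have h2 := (Finset.sum_eq_zero_iff_of_nonneg (fun y _ => hA x y)).1 h1 y (mem_univ _)
    simp only [SimpleGraph.adjMatrix_apply, hxy, if_true, one_mul] at h2
    have := pow_eq_zero_iff (two_ne_zero) |>.1 h2
    linarith
  intro x y
  obtain ⟨w⟩ := hconn.preconnected x y
  induction w with
  | nil => rfl
  | cons hxy _ ih => exact (hadj _ _ hxy).trans ih

lemma spectral_bound (A : Matrix V V ℝ) (hA : A.IsHermitian) (l : ℝ) (f : V → ℝ)
    (h : ∀ (μ : ℝ) (v : V → ℝ), v ≠ 0 → A.mulVec v = μ • v → μ ≤ l ∨ ∑ x, v x * f x = 0) :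
    ∑ x, f x * A.mulVec f x ≤ l * ∑ x, f x ^ 2 := by
  set b := hA.eigenvectorBasis
  set F : EuclideanSpace ℝ V := WithLp.toLp 2 f with hF
  set AF : EuclideanSpace ℝ V := WithLp.toLp 2 (A.mulVec f) with hAF
  have i0 : ∀ u v : EuclideanSpace ℝ V, inner ℝ u v = ∑ x, u x * v x := by
    intro u v
    rw [PiLp.inner_apply]
    exact Finset.sum_congr rfl fun x _ => by simp [mul_comm]
  have e1 : ∑ x, f x * A.mulVec f x = ∑ i, inner ℝ F (b i) * inner ℝ (b i) AF := by
    rw [b.sum_inner_mul_inner, i0]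
  have e2 : ∑ x, f x ^ 2 = ∑ i, inner ℝ F (b i) * inner ℝ (b i) F := by
    rw [b.sum_inner_mul_inner, i0]
    exact Finset.sum_congr rfl fun x _ => by simp [hF, sq]
  have ev : ∀ i, A.mulVec (b i).ofLp = hA.eigenvalues i • (b i).ofLp :=
    fun i => hA.mulVec_eigenvectorBasis i
  have e3 : ∀ i, inner ℝ (b i) AF = hA.eigenvalues i * inner ℝ (b i) F := by
    intro i
    have hT : A.transpose = A := by simpa using hA.eq
    have : (b i).ofLp ⬝ᵥ A.mulVec f = hA.eigenvalues i * ((b i).ofLp ⬝ᵥ f) := by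
      rw [Matrix.dotProduct_mulVec, ← Matrix.mulVec_transpose, hT, ev i, smul_dotProduct,
        smul_eq_mul]
    rw [i0, i0]
    exact this
  rw [e1, e2, Finset.mul_sum]
  refine Finset.sum_le_sum fun i _ => ?_
  rw [e3]
  have hsym : inner ℝ F (b i) = inner ℝ (b i) F := real_inner_comm _ _
  rw [hsym]
  have hne : (b i).ofLp ≠ 0 := by
    intro h0
    have : b i = 0 := by ext x; exact congrFun h0 x
    exact b.orthonormal.ne_zero i this
  rcases h _ _ hne (ev i) with hle | hz
  · nlinarith [mul_self_nonneg (inner ℝ (b i) F)]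
  · have : inner ℝ (b i) F = 0 := by rw [i0]; exact hz
    simp [this]

end CheegerAux

open CheegerAux
theorem stmt_13 {V : Type*} [Fintype V] [DecidableEq V]
    (G : SimpleGraph V) [DecidableRel G.Adj] (D : ℕ) (hD : 3 ≤ D)
    (hreg : G.IsRegularOfDegree D) (hconn : G.Connected)
    (lam2 h : ℝ)
    -- `lam2` is the second-largest adjacency eigenvalue: the largest eigenvalue other
    -- than the top eigenvalue `D` (which is simple since `G` is connected).
    (hlam : IsGreatest {μ : ℝ |
      Module.End.HasEigenvalue (Matrix.toLin' (G.adjMatrix ℝ)) μ ∧ μ ≠ (D : ℝ)} lam2)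
    -- `h` is the Cheeger constant (edge expansion) of `G`.
    (hh : IsLeast {r : ℝ | ∃ S : Finset V, S.Nonempty ∧ 2 * S.card ≤ Fintype.card V ∧
      r = ((Finset.univ.filter fun p : V × V =>
              p.1 ∈ S ∧ p.2 ∉ S ∧ G.Adj p.1 p.2).card : ℝ) / S.card} h) :
    ((D : ℝ) - lam2) / 2 ≤ h ∧ h ≤ Real.sqrt (2 * D * ((D : ℝ) - lam2)) := by
  obtain ⟨⟨hev, hne⟩, hmax⟩ := hlam
  set A : V → V → ℝ := fun x y => G.adjMatrix ℝ x y with hAdef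
  have hs : ∀ x y, A x y = A y x := by
    intro x y; simp [hAdef, SimpleGraph.adjMatrix_apply, G.adj_comm]
  have hA : ∀ x y, 0 ≤ A x y := by
    intro x y; simp only [hAdef, SimpleGraph.adjMatrix_apply]; split_ifs <;> norm_num
  have hdeg : ∀ x, ∑ y, A x y = (D : ℝ) := by
    intro x
    have := hreg x
    rw [← this, ← SimpleGraph.card_neighborFinset_eq_degree, SimpleGraph.neighborFinset_eq_filter]
    simp [hAdef, SimpleGraph.adjMatrix_apply]
  have hbd : ∀ S : Finset V, ((Finset.univ.filter fun p : V × V =>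
      p.1 ∈ S ∧ p.2 ∉ S ∧ G.Adj p.1 p.2).card : ℝ) = bd A S := by
    intro S
    unfold bd
    rw [Finset.card_filter, Nat.cast_sum, Fintype.sum_prod_type]
    refine Finset.sum_congr rfl fun x _ => Finset.sum_congr rfl fun y _ => ?_
    by_cases hx : x ∈ S <;> by_cases hy : y ∈ S <;> by_cases hxy : G.Adj x y <;>
      simp [hAdef, ind, hx, hy, hxy]
  simp only [hbd] at hh
  obtain ⟨g, hg⟩ := hev.exists_hasEigenvector
  have hg0 : g ≠ 0 := hg.2
  have hgA : ∀ x, ∑ y, A x y * g y = lam2 * g x := by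
    intro x
    have := congrFun hg.apply_eq_smul x
    simpa [Matrix.toLin'_apply, Matrix.mulVec, dotProduct, hAdef] using this
  have hnn : ∀ f : V → ℝ, 0 ≤ ∑ x, ∑ y, A x y * (f x + (-1) * f y) ^ 2 := fun f =>
    Finset.sum_nonneg fun x _ => Finset.sum_nonneg fun y _ => mul_nonneg (hA _ _) (sq_nonneg _)
  have hlD : lam2 ≤ D := by
    have h1 := hnn g
    rw [energy A hs D hdeg (-1) g] at h1
    have h2 : ∑ x, g x * ∑ y, A x y * g y = lam2 * ∑ x, g x ^ 2 := by
      rw [Finset.mul_sum]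
      exact Finset.sum_congr rfl fun x _ => by rw [hgA]; ring
    rw [h2] at h1
    have h3 : 0 < ∑ x, g x ^ 2 := by
      obtain ⟨x, hx⟩ := Function.ne_iff.1 hg0
      have hx' : g x ≠ 0 := hx
      exact Finset.sum_pos' (fun x _ => sq_nonneg _) ⟨x, mem_univ _, by positivity⟩
    by_contra hlt
    push Not at hlt
    nlinarith
  obtain ⟨⟨S, hSne, hScard, hSh⟩, hleast⟩ := hh
  have hcard : ∀ T : Finset V, T.Nonempty → (0 : ℝ) < T.card := fun T hT => by
    exact_mod_cast hT.card_pos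
  constructor
  · -- easy direction
    set n : ℝ := (Fintype.card V : ℝ) with hn
    set s : ℝ := (S.card : ℝ) with hsdef
    have hs0 : 0 < s := hcard S hSne
    have h2s : 2 * s ≤ n := by rw [hn, hsdef]; exact_mod_cast hScard
    have hn0 : 0 < n := by linarith
    set f : V → ℝ := fun x => ind S x - s / n with hf
    have hind : ∑ x, ind S x = s := by simp [ind, hsdef]
    have hsumf : ∑ x, f x = 0 := by
      simp only [hf, Finset.sum_sub_distrib, hind, Finset.sum_const, Finset.card_univ, nsmul_eq_mul]
      rw [← hn]; field_simp; ring
    have hsq : ∑ x, f x ^ 2 = s - s ^ 2 / n := by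
      have : ∀ x, f x ^ 2 = (1 - 2 * (s / n)) * ind S x + (s / n) ^ 2 := by
        intro x
        by_cases hx : x ∈ S
        · simp [hf, ind, hx]; ring
        · simp [hf, ind, hx]
      simp only [this, Finset.sum_add_distrib, ← Finset.mul_sum, hind, Finset.sum_const,
        Finset.card_univ, nsmul_eq_mul]
      rw [← hn]; field_simp; ring
    have hEn : ∑ x, ∑ y, A x y * (f x + (-1) * f y) ^ 2 = 2 * bd A S := by
      rw [← bd_two A hs S]
      refine Finset.sum_congr rfl fun x _ => Finset.sum_congr rfl fun y _ => ?_
      by_cases hx : x ∈ S <;> by_cases hy : y ∈ S <;>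
        simp only [hf, ind, hx, hy, if_true, if_false] <;> ring
    have hsp := spectral_bound (G.adjMatrix ℝ) (by
        rw [Matrix.IsHermitian, Matrix.conjTranspose_eq_transpose_of_trivial]
        exact G.transpose_adjMatrix) lam2 f (by
      intro μ v hv0 hv
      by_cases hμ : μ = D
      · right
        have hvA : ∀ x, ∑ y, A x y * v y = D * v x := by
          intro x
          have := congrFun hv x
          rw [hμ] at this
          simpa [Matrix.mulVec, dotProduct, hAdef] using this
        have hz : ∑ x, ∑ y, A x y * (v x + (-1) * v y) ^ 2 = 0 := by
          rw [energy A hs D hdeg (-1) v]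
          have h2 : ∑ x, v x * ∑ y, A x y * v y = D * ∑ x, v x ^ 2 := by
            rw [Finset.mul_sum]
            exact Finset.sum_congr rfl fun x _ => by rw [hvA]; ring
          rw [h2]; ring
        have hcst := const_of_energy G hconn v hz
        obtain ⟨z, _⟩ := hSne
        rw [Finset.sum_congr rfl fun x _ => by rw [hcst x z], ← Finset.mul_sum, hsumf, mul_zero]
      · left
        refine hmax ⟨?_, hμ⟩
        refine Module.End.hasEigenvalue_of_hasEigenvector (x := v)
          ⟨Module.End.mem_eigenspace_iff.2 ?_, hv0⟩
        rw [Matrix.toLin'_apply]; exact hv)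
    have hen := energy A hs D hdeg (-1) f
    have hsp' : ∑ x, f x * ∑ y, A x y * f y ≤ lam2 * ∑ x, f x ^ 2 := hsp
    rw [hEn] at hen
    have hhalf : s / 2 ≤ ∑ x, f x ^ 2 := by
      rw [hsq]
      have : s ^ 2 / n ≤ s / 2 := by
        rw [div_le_div_iff₀ hn0 two_pos]; nlinarith
      linarith
    rw [hSh, le_div_iff₀ hs0]
    have := mul_le_mul_of_nonneg_left hhalf (sub_nonneg.2 hlD)
    linarith
  · -- hard direction
    have hS' : ∀ T : Finset V, T.Nonempty → 2 * T.card ≤ Fintype.card V →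
        h * T.card ≤ bd A T := by
      intro T hT hTc
      have := hleast ⟨T, hT, hTc, rfl⟩
      rwa [le_div_iff₀ (hcard T hT)] at this
    have hh0 : 0 ≤ h := by
      rw [hSh, ← hbd]; positivity
    have hsumg : ∑ x, g x = 0 := by
      have h1 : ∑ x, ∑ y, A x y * g y = D * ∑ x, g x := by
        rw [Finset.sum_comm, Finset.mul_sum]
        refine Finset.sum_congr rfl fun y _ => ?_
        rw [← Finset.sum_mul, ← hdeg y]
        simp only [hs _ y]
      simp only [hgA, ← Finset.mul_sum] at h1
      have h2 : (lam2 - D) * ∑ x, g x = 0 := by linarith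
      exact (mul_eq_zero.1 h2).resolve_left (sub_ne_zero.2 hne)
    have hposneg : ∀ u : V → ℝ, u ≠ 0 → ∑ x, u x = 0 → ∃ x, 0 < u x := by
      intro u hu hsu
      by_contra hcon
      push Not at hcon
      apply hu
      funext x
      exact (Finset.sum_eq_zero_iff_of_nonpos fun x _ => hcon x).1 hsu x (mem_univ _)
    have hdisj : (univ.filter fun x => 0 < g x).card + (univ.filter fun x => 0 < (-g) x).card
        ≤ Fintype.card V := by
      rw [← Finset.card_union_of_disjoint]
      · exact Finset.card_le_univ _
      · rw [Finset.disjoint_filter]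
        intro x _ h1 h2
        simp only [Pi.neg_apply] at h2
        linarith
    apply Real.le_sqrt_of_sq_le
    by_cases hc : 2 * (univ.filter fun x => 0 < g x).card ≤ Fintype.card V
    · exact hard A hs hA D hdeg h _ hh0 hS' g lam2 hgA (hposneg g hg0 hsumg) hc
    · refine hard A hs hA D hdeg h _ hh0 hS' (-g) lam2 ?_
        (hposneg (-g) (neg_ne_zero.2 hg0) (by simp [hsumg])) (by omega)
      intro x
      simp [hgA]
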